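/- arXiv:2106.03589 — 3 statements merged into one kernel-verified Lean document; each statement's English description precedes it below -/
import Mathlib

section
/- Lipschitz bound for the normalized ramp (Lemma): Fix δ > 0 and define s_δ(x) := (x−δ)·1{x > δ} and s̄_δ(x) := s_δ(x)/x for x > 0 (with s̄_δ(0) := 0). Then the function x ↦ s̄_δ(√x) is 1/(2δ²)-Lipschitz on [0,∞). -/
open Set

/-- The normalized clipped ramp `s̄_δ(x) = s_δ(x)/x` (with `s̄_δ(0) := 0`), where
`s_δ(x) = (x − δ)·1{x > δ}`. -/
noncomputable def sbar (δ x : ℝ) : ℝ :=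
  if x = 0 then 0 else (if δ < x then x - δ else 0) / x

theorem sbar_eq (δ y : ℝ) (hδ : 0 < δ) : sbar δ y = 1 - δ / max y δ := by
  unfold sbar
  rcases lt_or_ge δ y with h | h
  · have hy : y ≠ 0 := by linarith
    rw [if_neg hy, if_pos h, max_eq_left h.le]
    field_simp
  · rw [if_neg (not_lt.mpr h), max_eq_right h, div_self hδ.ne']
    simp

theorem sbar_key (δ a b : ℝ) (hδ : 0 < δ) (ha : δ ≤ a) (hb : δ ≤ b) :
    |(1 - δ / a) - (1 - δ / b)| ≤ 1 / (2 * δ ^ 2) * |a ^ 2 - b ^ 2| := by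
  have ha0 : 0 < a := by linarith
  have hb0 : 0 < b := by linarith
  have e1 : (1 - δ / a) - (1 - δ / b) = (δ / (a * b)) * (a - b) := by
    field_simp
    ring
  have e2 : a ^ 2 - b ^ 2 = (a + b) * (a - b) := by ring
  rw [e1, e2, abs_mul, abs_mul, abs_of_pos (by positivity : 0 < δ / (a * b)),
    abs_of_pos (by positivity : 0 < a + b), ← mul_assoc]
  apply mul_le_mul_of_nonneg_right _ (abs_nonneg _)
  rw [one_div_mul_eq_div, div_le_div_iff₀ (by positivity) (by positivity)]
  have h1 : δ * δ ≤ a * b := mul_le_mul ha hb hδ.le ha0.le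
  have h2 : (2 * δ) * (δ * δ) ≤ (a + b) * (a * b) :=
    mul_le_mul (by linarith) h1 (by positivity) (by positivity)
  linarith

theorem sbar_sq (δ x : ℝ) (hδ : 0 < δ) (hx : 0 ≤ x) :
    (max (Real.sqrt x) δ) ^ 2 = max x (δ ^ 2) := by
  rcases le_total (Real.sqrt x) δ with h | h
  · rw [max_eq_right h, max_eq_right ((Real.sqrt_le_left hδ.le).mp h)]
  · rw [max_eq_left h, Real.sq_sqrt hx, max_eq_left ((Real.le_sqrt hδ.le hx).mp h)]

/-- **Lipschitz bound for the normalized ramp.** For any `δ > 0`, the function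
`x ↦ s̄_δ(√x)` is `1/(2δ²)`-Lipschitz on `[0,∞)`. -/
theorem sbar_sqrt_lipschitz (δ : ℝ) (hδ : 0 < δ) :
    LipschitzOnWith (Real.toNNReal (1 / (2 * δ ^ 2)))
      (fun x : ℝ => sbar δ (Real.sqrt x)) (Set.Ici 0) := by
  apply LipschitzOnWith.of_dist_le_mul
  intro x hx y hy
  rw [Real.coe_toNNReal _ (by positivity), Real.dist_eq, Real.dist_eq]
  simp only [sbar_eq δ _ hδ]
  refine (sbar_key δ _ _ hδ (le_max_right _ _) (le_max_right _ _)).trans ?_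
  rw [sbar_sq δ x hδ hx, sbar_sq δ y hδ hy]
  exact mul_le_mul_of_nonneg_left (abs_max_sub_max_le_abs _ _ _) (by positivity)
end

section
/- Generalized Barbalat's lemma: Let f : [0,∞) → ℝ be continuously differentiable, suppose f' is L-Lipschitz for some L > 0, and suppose that limsup_{t→∞} |f(t) − α| ≤ ε for some α ∈ ℝ and ε ≥ 0. Then limsup_{t→∞} |f'(t)| ≤ 2√(εL). -/
open Filter Set

lemma barbalat_aux (f f' : ℝ → ℝ) (L t h : ℝ) (hh : 0 ≤ h)
    (hd : ∀ s, t ≤ s → HasDerivAt f (f' s) s)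
    (hl : ∀ s, t ≤ s → f' t - L * (s - t) ≤ f' s) :
    f t + f' t * h - L * h ^ 2 / 2 ≤ f (t + h) := by
  have hg : ∀ s, t ≤ s → HasDerivAt (fun s => f s - f' t * (s - t) + L / 2 * (s - t) ^ 2)
      (f' s - f' t + L * (s - t)) s := by
    intro s hs
    have h1 : HasDerivAt (fun s : ℝ => s - t) 1 s := (hasDerivAt_id s).sub_const t
    have h2 := ((hd s hs).sub (h1.const_mul (f' t))).add ((h1.pow 2).const_mul (L / 2))
    refine h2.congr_deriv ?_
    norm_num
    ring
  have hm : MonotoneOn (fun s => f s - f' t * (s - t) + L / 2 * (s - t) ^ 2) (Set.Ici t) := by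
    apply monotoneOn_of_deriv_nonneg (convex_Ici t)
    · intro s hs
      exact (hg s hs).continuousAt.continuousWithinAt
    · intro s hs
      rw [interior_Ici] at hs
      exact (hg s (le_of_lt hs)).differentiableAt.differentiableWithinAt
    · intro s hs
      rw [interior_Ici] at hs
      rw [(hg s (le_of_lt hs)).deriv]
      linarith [hl s (le_of_lt hs)]
  have := hm (Set.mem_Ici.2 le_rfl) (Set.mem_Ici.2 (by linarith : t ≤ t + h)) (by linarith)
  simp only [sub_self, add_sub_cancel_left] at this
  nlinarith

/-- **Generalized Barbalat's lemma.**
If `f : [0,∞) → ℝ` is continuously differentiable with `L`-Lipschitz derivative `f'`,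
and `limsup_{t→∞} |f t − α| ≤ ε` (encoded by its epsilon-of-room characterization),
then `limsup_{t→∞} |f' t| ≤ 2√(εL)` (same encoding). -/
theorem generalized_barbalat
    (f f' : ℝ → ℝ) (L α ε : ℝ) (hL : 0 < L) (hε : 0 ≤ ε)
    (hderiv : ∀ t : ℝ, 0 ≤ t → HasDerivAt f (f' t) t)
    (hcont : ContinuousOn f' (Set.Ici (0 : ℝ)))
    (hlip : LipschitzOnWith (Real.toNNReal L) f' (Set.Ici (0 : ℝ)))
    (hlimsup : ∀ ε' : ℝ, ε < ε' → ∀ᶠ t in atTop, |f t - α| ≤ ε') :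
    ∀ c : ℝ, 2 * Real.sqrt (ε * L) < c → ∀ᶠ t in atTop, |f' t| ≤ c := by
  intro c hc
  have hc0 : 0 < c := lt_of_le_of_lt (by positivity) hc
  have hs : ε < c ^ 2 / (4 * L) := by
    rw [lt_div_iff₀ (by positivity)]
    have h1 := Real.sq_sqrt (mul_nonneg hε hL.le)
    have h2 := Real.sqrt_nonneg (ε * L)
    nlinarith
  obtain ⟨T, hT⟩ := eventually_atTop.1 (hlimsup _ hs)
  filter_upwards [eventually_ge_atTop T, eventually_ge_atTop 0] with t htT ht0
  have hl : ∀ s, t ≤ s → |f' s - f' t| ≤ L * (s - t) := by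
    intro s hs
    have := hlip.dist_le_mul s (Set.mem_Ici.2 (ht0.trans hs)) t (Set.mem_Ici.2 ht0)
    rwa [Real.dist_eq, Real.dist_eq, Real.coe_toNNReal L hL.le,
      abs_of_nonneg (sub_nonneg.2 hs)] at this
  have hh : 0 < c / L := by positivity
  have hA := abs_le.1 (hT t htT)
  have hB := abs_le.1 (hT (t + c / L) (by linarith))
  have h1 := barbalat_aux f f' L t (c / L) hh.le (fun s hs => hderiv s (ht0.trans hs))
    (fun s hs => by linarith [(abs_le.1 (hl s hs)).1])
  have h2 := barbalat_aux (fun s => - f s) (fun s => - f' s) L t (c / L) hh.le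
    (fun s hs => (hderiv s (ht0.trans hs)).neg)
    (fun s hs => by linarith [(abs_le.1 (hl s hs)).2])
  have e1 : L * (c / L) ^ 2 / 2 = c * (c / L) / 2 := by field_simp
  have e2 : c ^ 2 / (4 * L) = c * (c / L) / 4 := by field_simp
  rw [e1] at h1 h2
  rw [e2] at hA hB
  rw [abs_le]
  constructor
  · refine le_of_mul_le_mul_right ?_ hh
    linarith [hA.1, hA.2, hB.1, hB.2]
  · refine le_of_mul_le_mul_right ?_ hh
    linarith [hA.1, hA.2, hB.1, hB.2]
end

section
/- Sharpness of the generalized Barbalat lemma: Fix ε > 0 and ω > 0 and define f(t) := ε·sin(√(ω/ε)·t) for t ≥ 0. Then limsup_{t→∞} |f(t)| = ε, the derivative f'(t) = √(εω)·cos(√(ω/ε)·t) is ω-Lipschitz (and ω is the smallest valid global Lipschitz constant for f'), and limsup_{t→∞} |f'(t)| = √(εω). -/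
open Filter Set
open scoped NNReal

theorem limsup_abs_aux (g : ℝ → ℝ) (c k a : ℝ) (hk : 0 < k) (hle : ∀ t, g t ≤ c) (h0 : ∀ t, 0 ≤ g t)
    (heq : ∀ n : ℕ, g ((a + n * (2 * Real.pi)) / k) = c) :
    Filter.limsup g Filter.atTop = c := by
  have hfreq : ∃ᶠ t in Filter.atTop, c ≤ g t := by
    rw [Filter.frequently_atTop]
    intro b
    obtain ⟨n, hn⟩ := exists_nat_ge ((b * k - a) / (2 * Real.pi))
    refine ⟨(a + n * (2 * Real.pi)) / k, ?_, (heq n).ge⟩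
    rw [div_le_iff₀ (by positivity)] at hn
    rw [le_div_iff₀ hk]
    linarith
  have hb : Filter.IsBoundedUnder (· ≤ ·) Filter.atTop g :=
    Filter.isBoundedUnder_of ⟨c, hle⟩
  have hb' : Filter.IsBoundedUnder (· ≥ ·) Filter.atTop g :=
    Filter.isBoundedUnder_of ⟨0, h0⟩
  apply le_antisymm
  · exact Filter.limsup_le_of_le hb'.isCoboundedUnder_le (Filter.Eventually.of_forall hle)
  · exact Filter.le_limsup_of_frequently_le hfreq hb

/-- **Sharpness of the generalized Barbalat lemma.**
For `f(t) = ε·sin(√(ω/ε)·t)` with `ε, ω > 0`: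
`limsup_{t→∞}|f t| = ε`, the derivative is `f'(t) = √(εω)·cos(√(ω/ε)·t)`,
`f'` is `ω`-Lipschitz and `ω` is the smallest global Lipschitz constant for `f'`,
and `limsup_{t→∞}|f' t| = √(εω)`. -/
theorem barbalat_sharpness (ε ω : ℝ) (hε : 0 < ε) (hω : 0 < ω) :
    (Filter.limsup (fun t : ℝ => |ε * Real.sin (Real.sqrt (ω / ε) * t)|) Filter.atTop = ε) ∧
    (∀ t : ℝ, HasDerivAt (fun τ : ℝ => ε * Real.sin (Real.sqrt (ω / ε) * τ))
        (Real.sqrt (ε * ω) * Real.cos (Real.sqrt (ω / ε) * t)) t) ∧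
    LipschitzWith (Real.toNNReal ω)
      (fun t : ℝ => Real.sqrt (ε * ω) * Real.cos (Real.sqrt (ω / ε) * t)) ∧
    (∀ L : ℝ≥0, LipschitzWith L
        (fun t : ℝ => Real.sqrt (ε * ω) * Real.cos (Real.sqrt (ω / ε) * t)) → ω ≤ (L : ℝ)) ∧
    Filter.limsup (fun t : ℝ => |Real.sqrt (ε * ω) * Real.cos (Real.sqrt (ω / ε) * t)|)
        Filter.atTop = Real.sqrt (ε * ω) := by
  have hk : 0 < Real.sqrt (ω / ε) := Real.sqrt_pos.2 (by positivity)
  have hk2 : Real.sqrt (ω / ε) ^ 2 = ω / ε := Real.sq_sqrt (by positivity)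
  have hs : Real.sqrt (ε * ω) = ε * Real.sqrt (ω / ε) := by
    rw [Real.sqrt_eq_iff_mul_self_eq_of_pos (by positivity)]
    have : ε * √(ω / ε) * (ε * √(ω / ε)) = ε ^ 2 * √(ω / ε) ^ 2 := by ring
    rw [this, hk2]
    field_simp
  rw [hs]
  have hw : ε * Real.sqrt (ω / ε) * Real.sqrt (ω / ε) = ω := by
    rw [mul_assoc, ← sq, hk2]
    field_simp
  generalize Real.sqrt (ω / ε) = k at *
  have hd : ∀ t : ℝ, HasDerivAt (fun t : ℝ => ε * k * Real.cos (k * t))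
      (-(ω * Real.sin (k * t))) t := by
    intro t
    have h := (((hasDerivAt_id t).const_mul k).cos).const_mul (ε * k)
    refine HasDerivAt.congr_deriv h ?_
    rw [← hw]
    simp only [id]
    ring
  refine ⟨?_, ?_, ?_, ?_, ?_⟩
  · apply limsup_abs_aux _ _ k (Real.pi / 2) hk _ (fun t => abs_nonneg _)
    · intro n
      rw [mul_div_cancel₀ _ hk.ne', Real.sin_add_nat_mul_two_pi, Real.sin_pi_div_two, mul_one,
        abs_of_pos hε]
    · intro t
      rw [abs_mul, abs_of_pos hε]
      exact mul_le_of_le_one_right hε.le (Real.abs_sin_le_one _)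
  · intro t
    have h := (((hasDerivAt_id t).const_mul k).sin).const_mul ε
    refine HasDerivAt.congr_deriv h ?_
    simp only [id]
    ring
  · apply lipschitzWith_of_nnnorm_deriv_le (fun t => (hd t).differentiableAt)
    intro t
    rw [(hd t).deriv, ← NNReal.coe_le_coe, coe_nnnorm, Real.coe_toNNReal _ hω.le, norm_neg,
      Real.norm_eq_abs, abs_mul, abs_of_pos hω]
    exact mul_le_of_le_one_right hω.le (Real.abs_sin_le_one _)
  · intro L hL
    have h := norm_deriv_le_of_lipschitz (x₀ := Real.pi / 2 / k) hL
    rw [(hd _).deriv, mul_div_cancel₀ _ hk.ne', Real.sin_pi_div_two, mul_one, norm_neg,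
      Real.norm_eq_abs, abs_of_pos hω] at h
    exact h
  · have hεk : 0 < ε * k := by positivity
    apply limsup_abs_aux _ _ k 0 hk _ (fun t => abs_nonneg _)
    · intro n
      rw [mul_div_cancel₀ _ hk.ne', Real.cos_add_nat_mul_two_pi, Real.cos_zero, mul_one,
        abs_of_pos hεk]
    · intro t
      rw [abs_mul, abs_of_pos hεk]
      exact mul_le_of_le_one_right hεk.le (Real.abs_cos_le_one _)
end
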